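/- Let k be an infinite field and R = k[x,y] with homogeneous maximal ideal 𝔪 = (x,y). Let I be a nonzero proper homogeneous full ideal of R and let f be a nonzero homogeneous element of degree d with d ≥ o(I). Suppose I + (f) is full and μ(I + (f)) = μ(I) + 1. Then the colon ideal (I : f) is the principal ideal generated by a single linear form, i.e., (I : f) = (z) for some nonzero homogeneous z of degree 1. -/

import Mathlib

open MvPolynomial

noncomputable section

variable {k : Type*} [Field k]

/-- An ideal of a polynomial ring is homogeneous if it contains all homogeneous
components of its elements. -/
def IsHomogeneousIdeal {σ : Type*} (I : Ideal (MvPolynomial σ k)) : Prop :=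
  ∀ p ∈ I, ∀ d : ℕ, MvPolynomial.homogeneousComponent d p ∈ I

/-- The homogeneous maximal ideal `(x, y)` of `k[x,y]`. -/
def maxIdeal (k : Type*) [Field k] : Ideal (MvPolynomial (Fin 2) k) :=
  Ideal.span {X 0, X 1}

/-- A homogeneous ideal `I ⊆ k[x,y]` is full if `(I : z) = (I : 𝔪)` for some
linear form `z`. -/
def IsFull (I : Ideal (MvPolynomial (Fin 2) k)) : Prop :=
  ∃ z : MvPolynomial (Fin 2) k, z ≠ 0 ∧ z.IsHomogeneous 1 ∧
    Submodule.colon I (Ideal.span {z}) = Submodule.colon I (maxIdeal k)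

/-- The order `o(I)` of an ideal: the smallest degree of a nonzero homogeneous
element of `I`. -/
def ordDeg (I : Ideal (MvPolynomial (Fin 2) k)) : ℕ :=
  sInf {d : ℕ | ∃ p ∈ I, p ≠ 0 ∧ MvPolynomial.IsHomogeneous p d}

/-- The minimal number of generators of an ideal. -/
def mu (I : Ideal (MvPolynomial (Fin 2) k)) : ℕ :=
  sInf {n : ℕ | ∃ s : Finset (MvPolynomial (Fin 2) k), s.card = n ∧
    Ideal.span (s : Set (MvPolynomial (Fin 2) k)) = I}

namespace FullAux

theorem hc_mul {f : MvPolynomial (Fin 2) k} {d : ℕ} (hf : f.IsHomogeneous d) (g : MvPolynomial (Fin 2) k)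
    (n : ℕ) : homogeneousComponent (d + n) (f * g) = f * homogeneousComponent n g := by
  let _ := gradedAlgebra (σ := Fin 2) (R := k)
  have h := DirectSum.coe_decompose_mul_add_of_left_mem (homogeneousSubmodule (Fin 2) k)
    (a := f) (b := g) (i := d) (j := n) hf
  have e : ∀ (p : MvPolynomial (Fin 2) k) (i : ℕ),
    ((DirectSum.decompose (homogeneousSubmodule (Fin 2) k) p i : homogeneousSubmodule (Fin 2) k i) :
      MvPolynomial (Fin 2) k) = homogeneousComponent i p := fun p i =>
    decomposition.decompose'_apply p i
  rwa [e, e] at h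

theorem hc_mul_lt {f : MvPolynomial (Fin 2) k} {d : ℕ} (hf : f.IsHomogeneous d) (g : MvPolynomial (Fin 2) k)
    (n : ℕ) (hn : n < d) : homogeneousComponent n (f * g) = 0 := by
  let _ := gradedAlgebra (σ := Fin 2) (R := k)
  have h := DirectSum.coe_decompose_mul_of_left_mem_of_not_le (homogeneousSubmodule (Fin 2) k)
    (a := f) (b := g) (i := d) (n := n) hf (by omega)
  have e : ∀ (p : MvPolynomial (Fin 2) k) (i : ℕ),
    ((DirectSum.decompose (homogeneousSubmodule (Fin 2) k) p i : homogeneousSubmodule (Fin 2) k i) :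
      MvPolynomial (Fin 2) k) = homogeneousComponent i p := fun p i =>
    decomposition.decompose'_apply p i
  rwa [e] at h

/-- truncation -/
def trunc (N : ℕ) (p : MvPolynomial (Fin 2) k) : MvPolynomial (Fin 2) k :=
  ∑ i ∈ Finset.range (N + 1), homogeneousComponent i p

theorem trunc_add (N : ℕ) (p q : MvPolynomial (Fin 2) k) : trunc N (p + q) = trunc N p + trunc N q := by
  simp [trunc, Finset.sum_add_distrib]

theorem trunc_X_mul (N : ℕ) (j : Fin 2) (p : MvPolynomial (Fin 2) k) :
    trunc (N + 1) (X j * p) = X j * trunc N p := by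
  have hX := isHomogeneous_X k j
  rw [trunc, Finset.sum_range_succ', hc_mul_lt hX p 0 (by norm_num), add_zero, trunc, Finset.mul_sum]
  refine Finset.sum_congr rfl fun i _ => ?_
  rw [add_comm, hc_mul hX]

theorem trunc_eq_self {N : ℕ} {p : MvPolynomial (Fin 2) k} (h : p.totalDegree ≤ N) : trunc N p = p := by
  conv_rhs => rw [← sum_homogeneousComponent p]
  symm
  refine Finset.sum_subset (Finset.range_mono (by omega)) ?_
  intro x _ hx
  exact homogeneousComponent_eq_zero _ _ (by simp at hx; omega)

theorem trunc_degree (N : ℕ) (p : MvPolynomial (Fin 2) k) : (trunc N p).totalDegree ≤ N := by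
  refine (totalDegree_finsetSum _ _).trans (Finset.sup_le fun i hi => ?_)
  have := (homogeneousComponent_isHomogeneous i p).totalDegree_le
  simp at hi; omega

theorem trunc_mem {I : Ideal (MvPolynomial (Fin 2) k)} (hI : IsHomogeneousIdeal I) (N : ℕ)
    {p : MvPolynomial (Fin 2) k} (hp : p ∈ I) : trunc N p ∈ I :=
  I.sum_mem fun i _ => hI p hp i

theorem mem_of_hc {I : Ideal (MvPolynomial (Fin 2) k)} {p : MvPolynomial (Fin 2) k}
    (h : ∀ n, homogeneousComponent n p ∈ I) : p ∈ I := by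
  rw [← sum_homogeneousComponent p]
  exact I.sum_mem fun i _ => h i

/-- the truncated piece of an ideal -/
def TI (I : Ideal (MvPolynomial (Fin 2) k)) (N : ℕ) : Submodule k (MvPolynomial (Fin 2) k) :=
  I.restrictScalars k ⊓ restrictTotalDegree (Fin 2) k N

theorem mem_TI {I : Ideal (MvPolynomial (Fin 2) k)} {N : ℕ} {p : MvPolynomial (Fin 2) k} :
    p ∈ TI I N ↔ p ∈ I ∧ p.totalDegree ≤ N := by
  simp [TI, mem_restrictTotalDegree]

instance (I : Ideal (MvPolynomial (Fin 2) k)) (N : ℕ) : Module.Finite k (TI I N) :=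
  Submodule.finiteDimensional_of_le (S₂ := restrictTotalDegree (Fin 2) k N) inf_le_right

def G (I : Ideal (MvPolynomial (Fin 2) k)) (N : ℕ) : ℕ := Module.finrank k (TI I N)

theorem mem_maxIdeal_mul {I : Ideal (MvPolynomial (Fin 2) k)} {p : MvPolynomial (Fin 2) k} :
    p ∈ maxIdeal k * I ↔ ∃ a ∈ I, ∃ b ∈ I, p = X 0 * a + X 1 * b := by
  rw [maxIdeal, Ideal.span_insert, Ideal.sup_mul, Submodule.mem_sup]
  simp only [Ideal.mem_span_singleton_mul]
  constructor
  · rintro ⟨_, ⟨a, ha, rfl⟩, _, ⟨b, hb, rfl⟩, rfl⟩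
    exact ⟨a, ha, b, hb, rfl⟩
  · rintro ⟨a, ha, b, hb, rfl⟩
    exact ⟨_, ⟨a, ha, rfl⟩, _, ⟨b, hb, rfl⟩, rfl⟩

theorem mem_colon_max {I : Ideal (MvPolynomial (Fin 2) k)} {p : MvPolynomial (Fin 2) k} :
    p ∈ Submodule.colon I (maxIdeal k : Set (MvPolynomial (Fin 2) k)) ↔ X 0 * p ∈ I ∧ X 1 * p ∈ I := by
  rw [maxIdeal, Ideal.colon_span, Submodule.mem_colon]
  simp [mul_comm]

theorem mem_colon_one {I : Ideal (MvPolynomial (Fin 2) k)} {p z : MvPolynomial (Fin 2) k} :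
    p ∈ Submodule.colon I (Ideal.span {z} : Set (MvPolynomial (Fin 2) k)) ↔ z * p ∈ I := by
  rw [Ideal.colon_span, Submodule.mem_colon]
  simp [mul_comm]

/-- multiplication by `a` -/
def mulL (a : MvPolynomial (Fin 2) k) : MvPolynomial (Fin 2) k →ₗ[k] MvPolynomial (Fin 2) k :=
  LinearMap.mulLeft k a

theorem mulL_inj {a : MvPolynomial (Fin 2) k} (ha : a ≠ 0) : Function.Injective (mulL a) :=
  fun _ _ h => mul_left_cancel₀ ha h

theorem finrank_map_mulL {a : MvPolynomial (Fin 2) k} (ha : a ≠ 0) (V : Submodule k (MvPolynomial (Fin 2) k)) :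
    Module.finrank k (V.map (mulL a)) = Module.finrank k V :=
  (Submodule.equivMapOfInjective (mulL a) (mulL_inj ha) V).finrank_eq.symm

theorem deg_lin_mul {z : MvPolynomial (Fin 2) k} (hz : z ≠ 0) (h1 : z.IsHomogeneous 1)
    {p : MvPolynomial (Fin 2) k} {N : ℕ} : (z * p).totalDegree ≤ N + 1 ↔ p.totalDegree ≤ N := by
  by_cases hp : p = 0
  · simp [hp]
  · rw [totalDegree_mul_of_isDomain hz hp, h1.totalDegree hz]; omega

theorem dim_m_mul {I : Ideal (MvPolynomial (Fin 2) k)} (hI : IsHomogeneousIdeal I) (M : ℕ) :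
    G (maxIdeal k * I) (M + 2) + G (Submodule.colon I (maxIdeal k : Set (MvPolynomial (Fin 2) k))) M
      = 2 * G I (M + 1) := by
  have hX : ∀ j : Fin 2, (X j : MvPolynomial (Fin 2) k) ≠ 0 := fun j => X_ne_zero j
  have hH : ∀ j : Fin 2, (X j : MvPolynomial (Fin 2) k).IsHomogeneous 1 := fun j => isHomogeneous_X k j
  have e1 : TI (maxIdeal k * I) (M + 2) =
      (TI I (M + 1)).map (mulL (X 0)) ⊔ (TI I (M + 1)).map (mulL (X 1)) := by
    ext p
    rw [mem_TI, mem_maxIdeal_mul, Submodule.mem_sup]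
    constructor
    · rintro ⟨⟨a, ha, b, hb, h⟩, hd⟩
      refine ⟨_, ⟨trunc (M + 1) a, mem_TI.2 ⟨trunc_mem hI _ ha, trunc_degree _ _⟩, rfl⟩,
        _, ⟨trunc (M + 1) b, mem_TI.2 ⟨trunc_mem hI _ hb, trunc_degree _ _⟩, rfl⟩, ?_⟩
      change X 0 * _ + X 1 * _ = p
      rw [← trunc_X_mul, ← trunc_X_mul, ← trunc_add, ← h, trunc_eq_self hd]
    · rintro ⟨_, ⟨a, ha, rfl⟩, _, ⟨b, hb, rfl⟩, rfl⟩
      have ha := mem_TI.1 ha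
      have hb := mem_TI.1 hb
      refine ⟨⟨a, ha.1, b, hb.1, rfl⟩, (totalDegree_add _ _).trans (max_le ?_ ?_)⟩
      · exact (deg_lin_mul (hX 0) (hH 0)).2 ha.2
      · exact (deg_lin_mul (hX 1) (hH 1)).2 hb.2
  have e2 : (TI I (M + 1)).map (mulL (X 0)) ⊓ (TI I (M + 1)).map (mulL (X 1)) =
      (TI (Submodule.colon I (maxIdeal k : Set (MvPolynomial (Fin 2) k))) M).map (mulL (X 0 * X 1)) := by
    ext p
    rw [Submodule.mem_inf]
    constructor
    · rintro ⟨⟨a, ha, rfl⟩, ⟨b, hb, hab⟩⟩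
      have ha := mem_TI.1 ha
      have hb := mem_TI.1 hb
      change X 1 * b = X 0 * a at hab
      have hdv : (X 1 : MvPolynomial (Fin 2) k) ∣ X 0 * a := ⟨b, hab.symm⟩
      have hnd : ¬ (X 1 : MvPolynomial (Fin 2) k) ∣ X 0 := by
        rw [X_dvd_X]; simp
      obtain ⟨q, rfl⟩ := ((X_prime (R := k) (i := (1 : Fin 2))).dvd_or_dvd hdv).resolve_left hnd
      have hbq : b = X 0 * q := by
        apply mul_left_cancel₀ (hX 1); rw [hab]; ring
      subst hbq
      refine ⟨q, mem_TI.2 ⟨mem_colon_max.2 ⟨hb.1, ha.1⟩, (deg_lin_mul (hX 1) (hH 1)).1 ha.2⟩, ?_⟩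
      change X 0 * X 1 * q = X 0 * (X 1 * q)
      ring
    · rintro ⟨q, hq, rfl⟩
      obtain ⟨hq, hd⟩ := mem_TI.1 hq
      obtain ⟨h0, h1⟩ := mem_colon_max.1 hq
      refine ⟨⟨X 1 * q, mem_TI.2 ⟨h1, (deg_lin_mul (hX 1) (hH 1)).2 hd⟩, ?_⟩,
        ⟨X 0 * q, mem_TI.2 ⟨h0, (deg_lin_mul (hX 0) (hH 0)).2 hd⟩, ?_⟩⟩
      · change X 0 * (X 1 * q) = X 0 * X 1 * q; ring
      · change X 1 * (X 0 * q) = X 0 * X 1 * q; ring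
  have := Submodule.finrank_sup_add_finrank_inf_eq ((TI I (M + 1)).map (mulL (X 0)))
    ((TI I (M + 1)).map (mulL (X 1)))
  rw [← e1, e2, finrank_map_mulL (mul_ne_zero (hX 0) (hX 1)), finrank_map_mulL (hX 0),
    finrank_map_mulL (hX 1)] at this
  rw [G, G, G, this]; ring

/-- the linear form vanishing at `c` -/
def lin (c : Fin 2 → k) : MvPolynomial (Fin 2) k := C (c 1) * X 0 - C (c 0) * X 1

theorem lin_hom (c : Fin 2 → k) : (lin c).IsHomogeneous 1 := by
  have h : ∀ (a : k) (j : Fin 2), (C a * X j : MvPolynomial (Fin 2) k).IsHomogeneous 1 := fun a j => by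
    simpa using (isHomogeneous_C (Fin 2) a).mul (isHomogeneous_X k j)
  exact (h _ _).sub (h _ _)

theorem lin_ne_zero {c : Fin 2 → k} (hc : c ≠ 0) : lin c ≠ 0 := by
  intro h
  apply hc
  have h0 := congrArg (eval ![1, 0]) h
  have h1 := congrArg (eval ![0, 1]) h
  simp [lin] at h0 h1
  ext i; fin_cases i <;> simp [h0, h1]

theorem exists_lin {z : MvPolynomial (Fin 2) k} (hz : z.IsHomogeneous 1) : ∃ c, z = lin c := by
  have : z ∈ Submodule.span k (Set.range (X : Fin 2 → MvPolynomial (Fin 2) k)) := by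
    rw [← homogeneousSubmodule_one_eq_span_X]; exact hz
  obtain ⟨a, ha⟩ := (Submodule.mem_span_range_iff_exists_fun k).1 this
  refine ⟨![-a 1, a 0], ?_⟩
  rw [← ha]; simp [lin, smul_eq_C_mul]

theorem exists_lin' {z : MvPolynomial (Fin 2) k} (h0 : z ≠ 0) (hz : z.IsHomogeneous 1) :
    ∃ c, c ≠ 0 ∧ z = lin c := by
  obtain ⟨c, rfl⟩ := exists_lin hz
  refine ⟨c, ?_, rfl⟩
  rintro rfl
  exact h0 (by simp [lin])

/-- restriction to the line through `c` -/
def phi (c : Fin 2 → k) : MvPolynomial (Fin 2) k →ₐ[k] Polynomial k :=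
  aeval (fun i => Polynomial.C (c i) * Polynomial.X)

theorem phi_hom (c : Fin 2 → k) {p : MvPolynomial (Fin 2) k} {n : ℕ} (hp : p.IsHomogeneous n) :
    phi c p = Polynomial.C (eval c p) * Polynomial.X ^ n := by
  rw [phi, aeval_def, eval₂_eq', eval_eq', map_sum, Finset.sum_mul]
  refine Finset.sum_congr rfl fun d hd => ?_
  have hdeg : d 0 + d 1 = n := by
    have := hp (mem_support_iff.1 hd)
    rw [← this, Finsupp.weight_apply, Finsupp.sum_fintype _ _ (by simp)]
    simp
  rw [← hdeg]
  simp [Fin.prod_univ_two, mul_pow, pow_add]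
  ring

theorem phi_ker {c : Fin 2 → k} (hc : c ≠ 0) {p : MvPolynomial (Fin 2) k} :
    phi c p = 0 ↔ lin c ∣ p := by
  constructor
  · intro h
    have key : ∃ ψ : Polynomial k →ₐ[k] MvPolynomial (Fin 2) k,
        ∀ i, lin c ∣ X i - ψ (phi c (X i)) := by
      by_cases h0 : c 0 = 0
      · have h1 : c 1 ≠ 0 := by
          intro h1; apply hc; ext i; fin_cases i <;> simp [h0, h1]
        refine ⟨Polynomial.aeval (C (c 1)⁻¹ * X 1), fun i => ?_⟩
        have e : (C (c 1) * C (c 1)⁻¹ : MvPolynomial (Fin 2) k) = 1 := by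
          rw [← C_mul, mul_inv_cancel₀ h1, C_1]
        fin_cases i
        · refine ⟨C (c 1)⁻¹, ?_⟩
          simp [phi, lin, h0, algebraMap_eq]
          linear_combination (-X 0) * e
        · refine ⟨0, ?_⟩
          simp [phi, lin, h0, algebraMap_eq]
          linear_combination (-X 1) * e
      · refine ⟨Polynomial.aeval (C (c 0)⁻¹ * X 0), fun i => ?_⟩
        have e : (C (c 0) * C (c 0)⁻¹ : MvPolynomial (Fin 2) k) = 1 := by
          rw [← C_mul, mul_inv_cancel₀ h0, C_1]
        fin_cases i
        · refine ⟨0, ?_⟩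
          simp [phi, lin, algebraMap_eq]
          linear_combination (-X 0) * e
        · refine ⟨-C (c 0)⁻¹, ?_⟩
          simp [phi, lin, algebraMap_eq]
          linear_combination (-X 1) * e
    obtain ⟨ψ, hψ⟩ := key
    have e : (Ideal.Quotient.mkₐ k (Ideal.span {lin c})) =
        (Ideal.Quotient.mkₐ k (Ideal.span {lin c})).comp (ψ.comp (phi c)) := by
      apply MvPolynomial.algHom_ext
      intro i
      simp only [AlgHom.comp_apply, Ideal.Quotient.mkₐ_eq_mk]
      rw [Ideal.Quotient.eq, Ideal.mem_span_singleton]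
      exact hψ i
    have := DFunLike.congr_fun e p
    simp only [AlgHom.comp_apply, Ideal.Quotient.mkₐ_eq_mk, h, map_zero] at this
    rwa [Ideal.Quotient.eq_zero_iff_mem, Ideal.mem_span_singleton] at this
  · rintro ⟨q, rfl⟩
    rw [map_mul, phi_hom c (lin_hom c)]
    simp [lin, mul_comm]

theorem eval_ker {c : Fin 2 → k} (hc : c ≠ 0) {p : MvPolynomial (Fin 2) k} {n : ℕ}
    (hp : p.IsHomogeneous n) (h : eval c p = 0) : lin c ∣ p := by
  rw [← phi_ker hc, phi_hom c hp, h]; simp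

theorem dim_colon_lin (I : Ideal (MvPolynomial (Fin 2) k)) {c : Fin 2 → k} (hc : c ≠ 0) (M : ℕ) :
    Module.finrank k ((TI I (M + 1)).map (phi c).toLinearMap) +
      G (Submodule.colon I (Ideal.span {lin c} : Set (MvPolynomial (Fin 2) k))) M = G I (M + 1) := by
  have h := LinearMap.finrank_range_add_finrank_ker ((phi c).toLinearMap.domRestrict (TI I (M + 1)))
  rw [LinearMap.range_domRestrict] at h
  rw [G, G, ← h]
  congr 1
  rw [← finrank_map_mulL (lin_ne_zero hc),
    (Submodule.equivMapOfInjective (TI I (M + 1)).subtype (Submodule.injective_subtype _) _).finrank_eq]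
  have e : (TI (Submodule.colon I (Ideal.span {lin c} : Set (MvPolynomial (Fin 2) k))) M).map (mulL (lin c)) =
      ((phi c).toLinearMap.domRestrict (TI I (M + 1))).ker.map (TI I (M + 1)).subtype := by
    ext p
    constructor
    · rintro ⟨q, hq, rfl⟩
      obtain ⟨h1, h2⟩ := mem_TI.1 hq
      refine ⟨⟨lin c * q, mem_TI.2 ⟨mem_colon_one.1 h1, (deg_lin_mul (lin_ne_zero hc) (lin_hom c)).2 h2⟩⟩,
        ?_, rfl⟩
      exact (phi_ker hc).2 (Dvd.intro _ rfl)
    · rintro ⟨⟨p, hp⟩, hq, rfl⟩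
      obtain ⟨q, rfl⟩ := (phi_ker hc).1 hq
      obtain ⟨h1, h2⟩ := mem_TI.1 hp
      exact ⟨q, mem_TI.2 ⟨mem_colon_one.2 h1, (deg_lin_mul (lin_ne_zero hc) (lin_hom c)).1 h2⟩, rfl⟩
  rw [e]

theorem upper [Infinite k] {I : Ideal (MvPolynomial (Fin 2) k)} {p : MvPolynomial (Fin 2) k} {o : ℕ}
    (hp : p ∈ I) (hp0 : p ≠ 0) (ho : p.IsHomogeneous o) (M : ℕ) :
    (M + 2 - o) + G (Submodule.colon I (maxIdeal k : Set (MvPolynomial (Fin 2) k))) M ≤ G I (M + 1) := by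
  obtain ⟨c, hcp⟩ : ∃ c, eval c (X 0 * p) ≠ 0 := by
    by_contra! h
    exact mul_ne_zero (X_ne_zero (R := k) (0 : Fin 2)) hp0 (MvPolynomial.funext fun c => by simp [h c])
  have hc0 : c 0 ≠ 0 := fun h => hcp (by simp [h])
  have hc1 : eval c p ≠ 0 := fun h => hcp (by simp [h])
  have hc : c ≠ 0 := fun h => hc0 (by simp [h])
  rw [← dim_colon_lin I hc M]
  refine add_le_add ?_ ?_
  · have hli : LinearIndependent k (fun i : Fin (M + 2 - o) => (Polynomial.X ^ (o + i : ℕ) : Polynomial k)) := by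
      have := (Polynomial.basisMonomials k).linearIndependent
      have := this.comp (fun i : Fin (M + 2 - o) => o + (i : ℕ)) (fun a b h => by
        simpa [Fin.ext_iff] using h)
      convert this using 2
      simp [Polynomial.X_pow_eq_monomial]
    have h2 := finrank_span_eq_card hli
    rw [Fintype.card_fin] at h2
    rw [← h2]
    apply Submodule.finrank_mono
    rw [Submodule.span_le]
    rintro _ ⟨i, rfl⟩
    have hh : (X 0 ^ (i : ℕ) * p).IsHomogeneous (o + i) := by
      have := ((isHomogeneous_X k (0 : Fin 2)).pow (i : ℕ)).mul ho
      simpa [add_comm] using this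
    refine ⟨(eval c (X 0 ^ (i : ℕ) * p))⁻¹ • (X 0 ^ (i : ℕ) * p), ?_, ?_⟩
    · apply Submodule.smul_mem
      refine mem_TI.2 ⟨I.mul_mem_left _ hp, hh.totalDegree_le.trans ?_⟩
      have := i.2; omega
    · rw [AlgHom.toLinearMap_apply, map_smul, phi_hom c hh, Polynomial.smul_eq_C_mul, ← mul_assoc,
        ← Polynomial.C_mul, inv_mul_cancel₀, Polynomial.C_1, one_mul]
      simp [hc0, hc1]
  · apply Submodule.finrank_mono
    intro q hq
    obtain ⟨h1, h2⟩ := mem_TI.1 hq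
    obtain ⟨hx, hy⟩ := mem_colon_max.1 h1
    refine mem_TI.2 ⟨mem_colon_one.2 ?_, h2⟩
    have : lin c * q = C (c 1) * (X 0 * q) - C (c 0) * (X 1 * q) := by rw [lin]; ring
    rw [this]
    exact I.sub_mem (I.mul_mem_left _ hx) (I.mul_mem_left _ hy)

theorem lower {I : Ideal (MvPolynomial (Fin 2) k)} (hI : IsHomogeneousIdeal I) (hF : IsFull I) {o : ℕ}
    (ho : ∀ p ∈ I, p ≠ 0 → ∀ n, p.IsHomogeneous n → o ≤ n) (M : ℕ) :
    G I (M + 1) ≤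
    (M + 2 - o) + G (Submodule.colon I (maxIdeal k : Set (MvPolynomial (Fin 2) k))) M := by
  obtain ⟨z, hz0, hz1, hz⟩ := hF
  obtain ⟨c, hc, rfl⟩ := exists_lin' hz0 hz1
  rw [← hz, ← dim_colon_lin I hc M]
  refine Nat.add_le_add_right ?_ _
  classical
  let s : Finset (Polynomial k) := (Finset.Ico o (M + 2)).image fun i => Polynomial.X ^ i
  have h1 : s.card ≤ M + 2 - o := Finset.card_image_le.trans (by simp)
  refine le_trans ?_ ((finrank_span_finset_le_card (R := k) s).trans h1)
  apply Submodule.finrank_mono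
  rintro _ ⟨p, hp, rfl⟩
  obtain ⟨hpI, hpd⟩ := mem_TI.1 hp
  rw [AlgHom.toLinearMap_apply, ← trunc_eq_self hpd, trunc, map_sum]
  refine Submodule.sum_mem _ fun i hi => ?_
  have hh := homogeneousComponent_isHomogeneous i p
  by_cases h0 : homogeneousComponent i p = 0
  · rw [h0, map_zero]; exact Submodule.zero_mem _
  · rw [phi_hom c hh, ← Polynomial.smul_eq_C_mul]
    apply Submodule.smul_mem
    apply Submodule.subset_span
    have := ho _ (hI p hpI i) h0 i hh
    simp only [s, Finset.coe_image]
    refine ⟨i, ?_, rfl⟩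
    simp at hi ⊢; omega

/-- `𝔪 I` as a vector space -/
def Q (I : Ideal (MvPolynomial (Fin 2) k)) : Submodule k (MvPolynomial (Fin 2) k) :=
  (maxIdeal k * I).restrictScalars k

theorem mem_Q {I : Ideal (MvPolynomial (Fin 2) k)} {p : MvPolynomial (Fin 2) k} :
    p ∈ Q I ↔ p ∈ maxIdeal k * I := Iff.rfl

/-- `I / 𝔪 I` -/
def W (I : Ideal (MvPolynomial (Fin 2) k)) : Submodule k (MvPolynomial (Fin 2) k ⧸ Q I) :=
  (I.restrictScalars k).map (Q I).mkQ

def nu (I : Ideal (MvPolynomial (Fin 2) k)) : ℕ := Module.finrank k (W I)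

theorem sub_const_mem (r : MvPolynomial (Fin 2) k) : r - C (coeff 0 r) ∈ maxIdeal k := by
  have : r - C (coeff 0 r) ∈ maxIdeal k * ⊤ ↔ r - C (coeff 0 r) ∈ maxIdeal k := by
    rw [Ideal.mul_top]
  induction r using MvPolynomial.induction_on with
  | C a => simp
  | add p q hp hq =>
    have := Ideal.add_mem _ (hp (by rw [Ideal.mul_top])) (hq (by rw [Ideal.mul_top]))
    convert this using 1
    simp; ring
  | mul_X p i _ =>
    have : coeff 0 (p * X i) = 0 := by simp [coeff_mul_X']
    rw [this, C_0, sub_zero]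
    apply Ideal.mul_mem_left
    apply Ideal.subset_span
    fin_cases i <;> simp

theorem span_sup_Q {I : Ideal (MvPolynomial (Fin 2) k)} {s : Set (MvPolynomial (Fin 2) k)}
    (hs : Ideal.span s = I) : I.restrictScalars k ≤ Submodule.span k s ⊔ Q I := by
  intro p hp
  have hp : p ∈ Ideal.span s := by rw [hs]; exact hp
  induction hp using Submodule.span_induction with
  | mem x h => exact Submodule.mem_sup_left (Submodule.subset_span h)
  | zero => exact Submodule.zero_mem _
  | add x y hx hy h1 h2 =>
    exact Submodule.add_mem _ (h1 (by rw [← hs]; exact hx)) (h2 (by rw [← hs]; exact hy))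
  | smul a x hx h =>
    have hxI : x ∈ I := by rw [← hs]; exact hx
    have e : a • x = coeff 0 a • x + (a - C (coeff 0 a)) * x := by
      rw [smul_eq_mul, smul_eq_C_mul]; ring
    rw [e]
    exact Submodule.add_mem _ (Submodule.smul_mem _ _ (h hxI))
      (Submodule.mem_sup_right (mem_Q.2 (Ideal.mul_mem_mul (sub_const_mem a) hxI)))

theorem Q_le (I : Ideal (MvPolynomial (Fin 2) k)) : Q I ≤ I.restrictScalars k :=
  fun _ h => (Ideal.mul_le_right : maxIdeal k * I ≤ I) (mem_Q.1 h)

theorem W_eq {I : Ideal (MvPolynomial (Fin 2) k)} {s : Set (MvPolynomial (Fin 2) k)}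
    (hs : Ideal.span s = I) : W I = (Submodule.span k s).map (Q I).mkQ := by
  apply le_antisymm
  · refine (Submodule.map_mono (span_sup_Q hs)).trans ?_
    rw [Submodule.map_sup, Submodule.mkQ_map_self, sup_bot_eq]
  · apply Submodule.map_mono
    rw [Submodule.span_le, ← hs]
    exact Ideal.subset_span

theorem exists_gens (I : Ideal (MvPolynomial (Fin 2) k)) :
    ∃ s : Finset (MvPolynomial (Fin 2) k), Ideal.span (s : Set (MvPolynomial (Fin 2) k)) = I :=
  IsNoetherian.noetherian I

instance (I : Ideal (MvPolynomial (Fin 2) k)) : Module.Finite k (W I) := by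
  obtain ⟨s, hs⟩ := exists_gens I
  rw [W_eq hs]
  have : Module.Finite k (Submodule.span k (s : Set (MvPolynomial (Fin 2) k))) :=
    FiniteDimensional.span_finset k s
  infer_instance

theorem nu_le_mu (I : Ideal (MvPolynomial (Fin 2) k)) : nu I ≤ mu I := by
  obtain ⟨s, hs⟩ := exists_gens I
  have hne : {n : ℕ | ∃ s : Finset (MvPolynomial (Fin 2) k), s.card = n ∧
    Ideal.span (s : Set (MvPolynomial (Fin 2) k)) = I}.Nonempty := ⟨_, s, rfl, hs⟩
  obtain ⟨t, ht, ht2⟩ := Nat.sInf_mem hne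
  change t.card = mu I at ht
  rw [← ht, nu, W_eq ht2]
  have : Module.Finite k (Submodule.span k (t : Set (MvPolynomial (Fin 2) k))) :=
    FiniteDimensional.span_finset k t
  exact (Submodule.finrank_map_le _ _).trans (finrank_span_finset_le_card t)

theorem hc_of_hom {p : MvPolynomial (Fin 2) k} {m : ℕ} (hp : p.IsHomogeneous m) (n : ℕ) :
    homogeneousComponent n p = if n = m then p else 0 :=
  homogeneousComponent_of_mem hp

theorem mu_le_nu {I : Ideal (MvPolynomial (Fin 2) k)} (hI : IsHomogeneousIdeal I) : mu I ≤ nu I := by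
  classical
  let S : Set (MvPolynomial (Fin 2) k) := {p | p ∈ I ∧ ∃ n, p.IsHomogeneous n}
  obtain ⟨b, hbS, hbspan, hbli⟩ := exists_linearIndependent k ((Q I).mkQ '' S)
  have hSspan : Submodule.span k S = I.restrictScalars k := by
    apply le_antisymm
    · rw [Submodule.span_le]; exact fun p hp => hp.1
    · intro p hp
      rw [← sum_homogeneousComponent p]
      exact Submodule.sum_mem _ fun i _ => Submodule.subset_span
        ⟨hI p hp i, i, homogeneousComponent_isHomogeneous i p⟩
  have hW : Submodule.span k b = W I := by
    rw [hbspan, ← Submodule.map_span, hSspan, W]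
  have hfin : Module.Finite k (Submodule.span k b) := by rw [hW]; infer_instance
  have hbfin : b.Finite := by
    have h1 : LinearIndependent k (fun x : b => (⟨x.1, Submodule.subset_span x.2⟩ : Submodule.span k b)) := by
      apply LinearIndependent.of_comp (Submodule.span k b).subtype
      exact hbli
    have := h1.finite
    exact Set.toFinite b
  have : Fintype b := hbfin.fintype
  have hcard : Fintype.card b = nu I := by
    have := finrank_span_set_eq_card hbli
    rw [nu, ← hW, this, Set.toFinset_card]
  choose g hgS hg using fun v : b => hbS v.2
  let s : Finset (MvPolynomial (Fin 2) k) := Finset.univ.image g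
  have hscard : s.card ≤ nu I := by
    rw [← hcard]; exact Finset.card_image_le.trans (by simp)
  have hsS : ∀ p ∈ s, p ∈ S := by
    intro p hp
    obtain ⟨v, _, rfl⟩ := Finset.mem_image.1 hp
    exact hgS v
  have hspan : W I ≤ (Submodule.span k (s : Set (MvPolynomial (Fin 2) k))).map (Q I).mkQ := by
    rw [← hW, Submodule.span_le]
    intro v hv
    exact ⟨g ⟨v, hv⟩, Submodule.subset_span (by simp [s]), hg ⟨v, hv⟩⟩
  have hcs : ∀ p' ∈ Submodule.span k (s : Set (MvPolynomial (Fin 2) k)), ∀ n,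
      homogeneousComponent n p' ∈ Ideal.span (s : Set (MvPolynomial (Fin 2) k)) := by
    intro p' hp' n
    induction hp' using Submodule.span_induction with
    | mem x h =>
      obtain ⟨_, m, hm⟩ := hsS x h
      rw [hc_of_hom hm]
      split_ifs
      · exact Ideal.subset_span h
      · exact Ideal.zero_mem _
    | zero => rw [map_zero]; exact Ideal.zero_mem _
    | add x y _ _ h1 h2 => rw [map_add]; exact Ideal.add_mem _ h1 h2
    | smul a x _ h => rw [map_smul, smul_eq_C_mul]; exact Ideal.mul_mem_left _ _ h
  have hdec : ∀ p ∈ I, ∃ p' ∈ Submodule.span k (s : Set (MvPolynomial (Fin 2) k)),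
      ∃ a ∈ I, ∃ b ∈ I, p = p' + (X 0 * a + X 1 * b) := by
    intro p hp
    obtain ⟨p', hp', he⟩ := hspan ⟨p, hp, rfl⟩
    have : p - p' ∈ Q I := by
      rw [← Submodule.Quotient.mk_eq_zero, Submodule.Quotient.mk_sub, sub_eq_zero]
      exact he.symm
    obtain ⟨a, ha, b, hb, h⟩ := mem_maxIdeal_mul.1 (mem_Q.1 this)
    exact ⟨p', hp', a, ha, b, hb, by rw [← h]; ring⟩
  have hX := fun j : Fin 2 => isHomogeneous_X k j
  have hJ : ∀ n, ∀ p ∈ I, p.IsHomogeneous n → p ∈ Ideal.span (s : Set (MvPolynomial (Fin 2) k)) := by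
    intro n
    induction n with
    | zero =>
      intro p hp hh
      obtain ⟨p', hp', a, ha, b, hb, h⟩ := hdec p hp
      rw [← homogeneousComponent_eq_self hh, h, map_add, map_add,
        hc_mul_lt (hX 0) a 0 (by norm_num), hc_mul_lt (hX 1) b 0 (by norm_num), add_zero, add_zero]
      exact hcs p' hp' 0
    | succ n ih =>
      intro p hp hh
      obtain ⟨p', hp', a, ha, b, hb, h⟩ := hdec p hp
      rw [← homogeneousComponent_eq_self hh, h, map_add, map_add, add_comm n 1,
        hc_mul (hX 0) a n, hc_mul (hX 1) b n]
      exact Ideal.add_mem _ (hcs p' hp' _) (Ideal.add_mem _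
        (Ideal.mul_mem_left _ _ (ih _ (hI a ha n) (homogeneousComponent_isHomogeneous _ _)))
        (Ideal.mul_mem_left _ _ (ih _ (hI b hb n) (homogeneousComponent_isHomogeneous _ _))))
  refine le_trans (Nat.sInf_le ⟨s, rfl, ?_⟩) hscard
  apply le_antisymm
  · rw [Ideal.span_le]; exact fun p hp => (hsS p hp).1
  · intro p hp
    exact mem_of_hc fun n => hJ n _ (hI p hp n) (homogeneousComponent_isHomogeneous n p)

theorem mu_eq_nu {I : Ideal (MvPolynomial (Fin 2) k)} (hI : IsHomogeneousIdeal I) : mu I = nu I :=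
  le_antisymm (mu_le_nu hI) (nu_le_mu I)

theorem G_eq_nu (I : Ideal (MvPolynomial (Fin 2) k)) :
    ∃ N0, ∀ N ≥ N0, G I N = nu I + G (maxIdeal k * I) N := by
  obtain ⟨s, hs⟩ := exists_gens I
  refine ⟨s.sup totalDegree, fun N hN => ?_⟩
  have h := LinearMap.finrank_range_add_finrank_ker ((Q I).mkQ.domRestrict (TI I N))
  rw [LinearMap.range_domRestrict] at h
  have e1 : (TI I N).map (Q I).mkQ = W I := by
    apply le_antisymm
    · exact Submodule.map_mono inf_le_left
    · rw [W_eq hs]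
      apply Submodule.map_mono
      rw [Submodule.span_le]
      intro p hp
      refine mem_TI.2 ⟨by rw [← hs]; exact Ideal.subset_span hp, (Finset.le_sup (f := totalDegree) hp).trans hN⟩
  have e2 : ((Q I).mkQ.domRestrict (TI I N)).ker.map (TI I N).subtype = TI (maxIdeal k * I) N := by
    ext p
    constructor
    · rintro ⟨⟨p, hp⟩, hq, rfl⟩
      have hq : (Q I).mkQ p = 0 := hq
      rw [Submodule.mkQ_apply, Submodule.Quotient.mk_eq_zero] at hq
      exact mem_TI.2 ⟨hq, (mem_TI.1 hp).2⟩
    · intro hp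
      obtain ⟨h1, h2⟩ := mem_TI.1 hp
      refine ⟨⟨p, mem_TI.2 ⟨Q_le I h1, h2⟩⟩, ?_, rfl⟩
      change (Q I).mkQ p = 0
      rw [Submodule.mkQ_apply, Submodule.Quotient.mk_eq_zero]
      exact h1
  rw [e1, (Submodule.equivMapOfInjective (TI I N).subtype (Submodule.injective_subtype _) _).finrank_eq, e2] at h
  exact h.symm

theorem Q_mono {I K : Ideal (MvPolynomial (Fin 2) k)} (h : I ≤ K) : Q I ≤ Q K :=
  fun _ hp => Ideal.mul_mono_right h hp

/-- the map `R / 𝔪 I → R / 𝔪 K` -/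
def u {I K : Ideal (MvPolynomial (Fin 2) k)} (h : I ≤ K) :
    (MvPolynomial (Fin 2) k ⧸ Q I) →ₗ[k] (MvPolynomial (Fin 2) k ⧸ Q K) :=
  Submodule.mapQ (Q I) (Q K) LinearMap.id (Q_mono h)

theorem map_u_W {I K : Ideal (MvPolynomial (Fin 2) k)} (h : I ≤ K) :
    (W I).map (u h) = (I.restrictScalars k).map (Q K).mkQ := by
  rw [W, ← Submodule.map_comp]
  congr 1

theorem inj_of_nu {I : Ideal (MvPolynomial (Fin 2) k)} {f : MvPolynomial (Fin 2) k}
    (hnu : nu (I + Ideal.span {f}) = nu I + 1) {p : MvPolynomial (Fin 2) k} (hp : p ∈ I)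
    (hp2 : p ∈ maxIdeal k * (I + Ideal.span {f})) : p ∈ maxIdeal k * I := by
  have hle : I ≤ I + Ideal.span {f} := le_sup_left
  have h1 : nu (I + Ideal.span {f}) ≤ Module.finrank k ((W I).map (u hle)) + 1 := by
    have e : W (I + Ideal.span {f}) ≤ (W I).map (u hle) ⊔
        Submodule.span k {(Q (I + Ideal.span {f})).mkQ f} := by
      have : Ideal.span ((I : Set (MvPolynomial (Fin 2) k)) ∪ {f}) = I + Ideal.span {f} := by
        rw [Ideal.span_union, Ideal.span_eq]; rfl
      rw [W_eq this, Submodule.span_union, Submodule.map_sup, map_u_W]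
      refine sup_le_sup (Submodule.map_mono ?_) ?_
      · rw [Submodule.span_le]; exact fun _ h => h
      · rw [Submodule.map_span, Set.image_singleton]
    refine (Submodule.finrank_mono e).trans ((Submodule.finrank_add_le_finrank_add_finrank _ _).trans ?_)
    refine Nat.add_le_add_left ?_ _
    have := finrank_span_finset_le_card (R := k) {(Q (I + Ideal.span {f})).mkQ f}
    rw [Finset.coe_singleton, Finset.card_singleton] at this
    exact this
  have h2 := LinearMap.finrank_range_add_finrank_ker ((u hle).domRestrict (W I))
  rw [LinearMap.range_domRestrict] at h2
  change _ = nu I at h2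
  have h3 : Module.finrank k ((u hle).domRestrict (W I)).ker = 0 := by omega
  rw [Submodule.finrank_eq_zero] at h3
  have h4 : (⟨(Q I).mkQ p, ⟨p, hp, rfl⟩⟩ : W I) ∈ ((u hle).domRestrict (W I)).ker := by
    change (Q (I + Ideal.span {f})).mkQ p = 0
    rw [Submodule.mkQ_apply, Submodule.Quotient.mk_eq_zero]
    exact hp2
  rw [h3, Submodule.mem_bot] at h4
  have h5 : (Q I).mkQ p = 0 := congrArg Subtype.val h4
  rw [Submodule.mkQ_apply, Submodule.Quotient.mk_eq_zero] at h5
  exact h5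

theorem le_of_inj {I K : Ideal (MvPolynomial (Fin 2) k)} (h : I ≤ K) (hnu : nu K ≤ nu I)
    (hinj : ∀ p ∈ I, p ∈ maxIdeal k * K → p ∈ maxIdeal k * I) {p : MvPolynomial (Fin 2) k} (hp : p ∈ K) :
    ∃ i ∈ I, p - i ∈ maxIdeal k * K := by
  have h2 := LinearMap.finrank_range_add_finrank_ker ((u h).domRestrict (W I))
  rw [LinearMap.range_domRestrict] at h2
  have h3 : ((u h).domRestrict (W I)).ker = ⊥ := by
    rw [eq_bot_iff]
    rintro ⟨_, ⟨p, hp, rfl⟩⟩ hq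
    have hq : (Q K).mkQ p = 0 := hq
    rw [Submodule.mkQ_apply, Submodule.Quotient.mk_eq_zero] at hq
    rw [Submodule.mem_bot]
    apply Subtype.ext
    change (Q I).mkQ p = 0
    rw [Submodule.mkQ_apply, Submodule.Quotient.mk_eq_zero]
    exact hinj p hp hq
  rw [h3, finrank_bot, add_zero] at h2
  have hle : (W I).map (u h) ≤ W K := by
    rw [map_u_W]; exact Submodule.map_mono h
  have := Submodule.eq_of_le_of_finrank_le hle (by rw [h2]; exact hnu)
  have hpW : (Q K).mkQ p ∈ W K := ⟨p, hp, rfl⟩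
  rw [← this, map_u_W] at hpW
  obtain ⟨i, hi, hip⟩ := hpW
  refine ⟨i, hi, ?_⟩
  rw [← mem_Q, ← Submodule.Quotient.mk_eq_zero, Submodule.Quotient.mk_sub, sub_eq_zero]
  exact hip.symm

/-- graded piece -/
def HI (I : Ideal (MvPolynomial (Fin 2) k)) (n : ℕ) : Submodule k (MvPolynomial (Fin 2) k) :=
  I.restrictScalars k ⊓ homogeneousSubmodule (Fin 2) k n

theorem mem_HI {I : Ideal (MvPolynomial (Fin 2) k)} {n : ℕ} {p : MvPolynomial (Fin 2) k} :
    p ∈ HI I n ↔ p ∈ I ∧ p.IsHomogeneous n := by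
  simp [HI]

instance (I : Ideal (MvPolynomial (Fin 2) k)) (n : ℕ) : Module.Finite k (HI I n) :=
  Submodule.finiteDimensional_of_le (S₂ := TI I n) fun _ hp =>
    mem_TI.2 ⟨(mem_HI.1 hp).1, (mem_HI.1 hp).2.totalDegree_le⟩

theorem G_succ {I : Ideal (MvPolynomial (Fin 2) k)} (hI : IsHomogeneousIdeal I) (N : ℕ) :
    G I (N + 1) = Module.finrank k (HI I (N + 1)) + G I N := by
  have h := LinearMap.finrank_range_add_finrank_ker
    ((homogeneousComponent (σ := Fin 2) (R := k) (N + 1)).domRestrict (TI I (N + 1)))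
  rw [LinearMap.range_domRestrict] at h
  have e1 : (TI I (N + 1)).map (homogeneousComponent (N + 1)) = HI I (N + 1) := by
    ext p
    constructor
    · rintro ⟨p, hp, rfl⟩
      exact mem_HI.2 ⟨hI p (mem_TI.1 hp).1 _, homogeneousComponent_isHomogeneous _ _⟩
    · intro hp
      obtain ⟨h1, h2⟩ := mem_HI.1 hp
      exact ⟨p, mem_TI.2 ⟨h1, h2.totalDegree_le⟩, homogeneousComponent_eq_self h2⟩
  have e2 : ((homogeneousComponent (σ := Fin 2) (R := k) (N + 1)).domRestrict (TI I (N + 1))).ker.map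
      (TI I (N + 1)).subtype = TI I N := by
    ext p
    constructor
    · rintro ⟨⟨p, hp⟩, hq, rfl⟩
      have hq : homogeneousComponent (N + 1) p = 0 := hq
      obtain ⟨h1, h2⟩ := mem_TI.1 hp
      refine mem_TI.2 ⟨h1, ?_⟩
      have := trunc_eq_self h2
      rw [trunc, Finset.sum_range_succ, hq, add_zero] at this
      change p.totalDegree ≤ N
      rw [← this]
      exact trunc_degree N p
    · intro hp
      obtain ⟨h1, h2⟩ := mem_TI.1 hp
      refine ⟨⟨p, mem_TI.2 ⟨h1, by omega⟩⟩, ?_, rfl⟩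
      change homogeneousComponent (N + 1) p = 0
      exact homogeneousComponent_eq_zero _ _ (by omega)
  rw [e1, (Submodule.equivMapOfInjective (TI I (N + 1)).subtype (Submodule.injective_subtype _) _).finrank_eq, e2] at h
  exact h.symm

theorem slope_le [Infinite k] {I : Ideal (MvPolynomial (Fin 2) k)} (hI : IsHomogeneousIdeal I)
    {p : MvPolynomial (Fin 2) k} {o : ℕ}
    (hp : p ∈ I) (hp0 : p ≠ 0) (ho : p.IsHomogeneous o) :
    ∃ N0, ∀ N ≥ N0, nu I + (N - o) ≤ Module.finrank k (HI I N) := by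
  obtain ⟨N0, hN0⟩ := G_eq_nu I
  refine ⟨N0 + 2, fun N hN => ?_⟩
  obtain ⟨M, rfl⟩ : ∃ M, N = M + 2 := ⟨N - 2, by omega⟩
  have h1 := hN0 (M + 2) (by omega)
  have h2 := dim_m_mul hI M
  have h3 := upper hp hp0 ho M
  have h4 : G I (M + 2) = Module.finrank k (HI I (M + 2)) + G I (M + 1) := G_succ hI (M + 1)
  omega

theorem slope_ge {I : Ideal (MvPolynomial (Fin 2) k)} (hI : IsHomogeneousIdeal I) (hF : IsFull I) {o : ℕ}
    (ho : ∀ p ∈ I, p ≠ 0 → ∀ n, p.IsHomogeneous n → o ≤ n) :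
    ∃ N0, ∀ N ≥ N0, Module.finrank k (HI I N) ≤ nu I + (N - o) := by
  obtain ⟨N0, hN0⟩ := G_eq_nu I
  refine ⟨N0 + 2, fun N hN => ?_⟩
  obtain ⟨M, rfl⟩ : ∃ M, N = M + 2 := ⟨N - 2, by omega⟩
  have h1 := hN0 (M + 2) (by omega)
  have h2 := dim_m_mul hI M
  have h3 := lower hI hF ho M
  have h4 : G I (M + 2) = Module.finrank k (HI I (M + 2)) + G I (M + 1) := G_succ hI (M + 1)
  omega

theorem hc_add_mul {I : Ideal (MvPolynomial (Fin 2) k)} (hI : IsHomogeneousIdeal I)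
    {f : MvPolynomial (Fin 2) k} {d : ℕ} (hf : f.IsHomogeneous d) {q : MvPolynomial (Fin 2) k}
    (hq : q ∈ I + Ideal.span {f}) (n : ℕ) :
    ∃ i ∈ I, i.IsHomogeneous n ∧ ((n < d ∧ homogeneousComponent n q = i) ∨
      ∃ m r, n = d + m ∧ r.IsHomogeneous m ∧ homogeneousComponent n q = i + f * r) := by
  rw [Submodule.add_eq_sup, Submodule.mem_sup] at hq
  obtain ⟨i, hi, _, hy, rfl⟩ := hq
  obtain ⟨r, rfl⟩ := Ideal.mem_span_singleton.1 hy
  refine ⟨homogeneousComponent n i, hI i hi n, homogeneousComponent_isHomogeneous _ _, ?_⟩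
  rcases lt_or_ge n d with h | h
  · left
    exact ⟨h, by rw [map_add, hc_mul_lt hf r n h, add_zero]⟩
  · right
    obtain ⟨m, rfl⟩ := Nat.exists_eq_add_of_le h
    exact ⟨m, homogeneousComponent m r, rfl, homogeneousComponent_isHomogeneous _ _,
      by rw [map_add, hc_mul hf]⟩

theorem add_hom {I : Ideal (MvPolynomial (Fin 2) k)} (hI : IsHomogeneousIdeal I)
    {f : MvPolynomial (Fin 2) k} {d : ℕ} (hf : f.IsHomogeneous d) :
    IsHomogeneousIdeal (I + Ideal.span {f}) := by
  intro q hq n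
  obtain ⟨i, hi, _, h | ⟨m, r, _, _, h⟩⟩ := hc_add_mul hI hf hq n
  · rw [h.2]; exact Ideal.mem_sup_left hi
  · rw [h]; exact Ideal.add_mem _ (Ideal.mem_sup_left hi)
      (Ideal.mem_sup_right (Ideal.mul_mem_right _ _ (Ideal.mem_span_singleton_self f)))

theorem one_dim {A B : Submodule k (MvPolynomial (Fin 2) k)} [Module.Finite k B] (hAB : A ≤ B)
    (h : Module.finrank k B = Module.finrank k A + 1) :
    (∃ b ∈ B, b ∉ A) ∧ ∀ b ∈ B, b ∉ A → ∀ r ∈ B, ∃ t : k, r - t • b ∈ A := by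
  constructor
  · by_contra! hh
    have : A = B := le_antisymm hAB hh
    subst this
    omega
  · intro b hb hbA r hr
    have : Module.Finite k A := Submodule.finiteDimensional_of_le hAB
    have hle : A ⊔ Submodule.span k {b} ≤ B := sup_le hAB (by
      rw [Submodule.span_le]; simpa using hb)
    have hlt : A < A ⊔ Submodule.span k {b} := by
      refine lt_of_le_of_ne le_sup_left fun he => hbA ?_
      rw [he]
      exact Submodule.mem_sup_right (Submodule.mem_span_singleton_self b)
    have hfin : Module.Finite k ↥(A ⊔ Submodule.span k {b}) := Submodule.finiteDimensional_of_le hle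
    have h1 := Submodule.finrank_lt_finrank_of_lt hlt
    have h2 := Submodule.eq_of_le_of_finrank_le hle (by omega)
    rw [← h2, Submodule.mem_sup] at hr
    obtain ⟨a, ha, y, hy, rfl⟩ := hr
    obtain ⟨t, rfl⟩ := Submodule.mem_span_singleton.1 hy
    exact ⟨t, by simpa using ha⟩

theorem main [Infinite k]
    (I : Ideal (MvPolynomial (Fin 2) k))
    (hI0 : I ≠ ⊥)
    (hIhom : IsHomogeneousIdeal I) (hIfull : IsFull I)
    (f : MvPolynomial (Fin 2) k) (d : ℕ) (hfhom : f.IsHomogeneous d)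
    (hd : ordDeg I ≤ d)
    (hsumfull : IsFull (I + Ideal.span {f}))
    (hmu : mu (I + Ideal.span {f}) = mu I + 1) :
    ∃ z : MvPolynomial (Fin 2) k, z ≠ 0 ∧ z.IsHomogeneous 1 ∧
      Submodule.colon I (Ideal.span {f}) = Ideal.span {z} := by
  have hI'hom := add_hom hIhom hfhom
  rw [mu_eq_nu hIhom, mu_eq_nu hI'hom] at hmu
  have hle : I ≤ I + Ideal.span {f} := le_sup_left
  have hfI' : f ∈ I + Ideal.span {f} := Ideal.mem_sup_right (Ideal.mem_span_singleton_self f)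
  -- order
  obtain ⟨p, hp, hp0, hpo⟩ : ∃ p ∈ I, p ≠ 0 ∧ p.IsHomogeneous (ordDeg I) := by
    apply Nat.sInf_mem (s := {d : ℕ | ∃ p ∈ I, p ≠ 0 ∧ MvPolynomial.IsHomogeneous p d})
    obtain ⟨q, hq, hq0⟩ := Submodule.exists_mem_ne_zero_of_ne_bot hI0
    by_contra hne
    apply hq0
    rw [← sum_homogeneousComponent q]
    refine Finset.sum_eq_zero fun i _ => ?_
    by_contra h0
    exact hne ⟨i, _, hIhom q hq i, h0, homogeneousComponent_isHomogeneous _ _⟩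
  have ho : ∀ p ∈ I, p ≠ 0 → ∀ n, p.IsHomogeneous n → ordDeg I ≤ n :=
    fun p hp h0 n hn => Nat.sInf_le ⟨p, hp, h0, hn⟩
  generalize ordDeg I = o at *
  have ho' : ∀ p ∈ I + Ideal.span {f}, p ≠ 0 → ∀ n, p.IsHomogeneous n → o ≤ n := by
    intro q hq hq0 n hn
    obtain ⟨i, hi, hin, h | ⟨m, r, hm, _, _⟩⟩ := hc_add_mul hIhom hfhom hq n
    · rw [homogeneousComponent_eq_self hn] at h
      exact ho q (by rw [h.2]; exact hi) hq0 n hn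
    · omega
  -- eventual Hilbert functions
  obtain ⟨N1, hN1⟩ := slope_le hIhom hp hp0 hpo
  obtain ⟨N2, hN2⟩ := slope_ge hIhom hIfull ho
  obtain ⟨N3, hN3⟩ := slope_le hI'hom (hle hp) hp0 hpo
  obtain ⟨N4, hN4⟩ := slope_ge hI'hom hsumfull ho'
  have hH : ∀ n ≥ N1 + N2 + N3 + N4, Module.finrank k (HI (I + Ideal.span {f}) n) =
      Module.finrank k (HI I n) + 1 := by
    intro n hn
    have h1 := hN1 n (by omega)
    have h2 := hN2 n (by omega)
    have h3 := hN3 n (by omega)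
    have h4 := hN4 n (by omega)
    omega
  generalize hN : N1 + N2 + N3 + N4 = N at hH
  have hHle : ∀ n, HI I n ≤ HI (I + Ideal.span {f}) n := fun n => inf_le_inf_right _ hle
  have hfr : ∀ j r, r.IsHomogeneous j → f * r ∈ HI (I + Ideal.span {f}) (d + j) := fun j r hr =>
    mem_HI.2 ⟨Ideal.mul_mem_right _ _ hfI', hfhom.mul hr⟩
  -- fact 1
  have fact1 : ∀ j ≥ N, ∃ w : MvPolynomial (Fin 2) k, w.IsHomogeneous j ∧ f * w ∉ I := by
    intro j hj
    obtain ⟨⟨b, hb, hbI⟩, -⟩ := one_dim (hHle (d + j)) (hH (d + j) (by omega))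
    obtain ⟨hb1, hb2⟩ := mem_HI.1 hb
    obtain ⟨i, hi, hin, h | ⟨m, r, hm, hr, h⟩⟩ := hc_add_mul hIhom hfhom hb1 (d + j)
    · omega
    · rw [homogeneousComponent_eq_self hb2] at h
      obtain rfl : j = m := by omega
      refine ⟨r, hr, fun hfr => hbI (mem_HI.2 ⟨?_, hb2⟩)⟩
      rw [h]; exact I.add_mem hi hfr
  -- fact 2
  have fact2 : ∀ j ≥ N, ∀ w : MvPolynomial (Fin 2) k, w.IsHomogeneous j → f * w ∉ I →
      ∀ r : MvPolynomial (Fin 2) k, r.IsHomogeneous j → ∃ t : k, f * (r - C t * w) ∈ I := by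
    intro j hj w hw hwI r hr
    obtain ⟨-, h⟩ := one_dim (hHle (d + j)) (hH (d + j) (by omega))
    obtain ⟨t, ht⟩ := h (f * w) (hfr j w hw) (fun hh => hwI (mem_HI.1 hh).1) (f * r) (hfr j r hr)
    refine ⟨t, ?_⟩
    have := (mem_HI.1 ht).1
    rw [smul_eq_C_mul] at this
    convert this using 1
    ring
  -- the linear form
  obtain ⟨c, hc, hcL⟩ : ∃ c : Fin 2 → k, c ≠ 0 ∧
      ∀ r : MvPolynomial (Fin 2) k, r.IsHomogeneous N → f * (lin c * r) ∈ I := by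
    obtain ⟨w, hw, hwI⟩ := fact1 N le_rfl
    obtain ⟨c, hc, hcw⟩ : ∃ c : Fin 2 → k, c ≠ 0 ∧ f * (lin c * w) ∈ I := by
      have hx : ∀ i : Fin 2, (X i * w).IsHomogeneous (N + 1) := fun i => by
        rw [add_comm]; exact (isHomogeneous_X k i).mul hw
      by_cases h0 : f * (X 0 * w) ∈ I
      · refine ⟨![0, 1], fun h => by simpa using congrFun h 1, ?_⟩
        simpa [lin] using h0
      · obtain ⟨t, ht⟩ := fact2 (N + 1) (by omega) _ (hx 0) h0 _ (hx 1)
        refine ⟨![-1, -t], fun h => by simpa using congrFun h 0, ?_⟩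
        convert ht using 1
        simp only [lin, Matrix.cons_val_zero, Matrix.cons_val_one, map_neg, C_1]; ring
    refine ⟨c, hc, fun r hr => ?_⟩
    obtain ⟨t, ht⟩ := fact2 N le_rfl w hw hwI r hr
    have : f * (lin c * r) = lin c * (f * (r - C t * w)) + C t * (f * (lin c * w)) := by ring
    rw [this]
    exact I.add_mem (I.mul_mem_left _ ht) (I.mul_mem_left _ hcw)
  have hcL' : ∀ j, ∀ r : MvPolynomial (Fin 2) k, r.IsHomogeneous (N + j) → f * (lin c * r) ∈ I := by
    intro j r hr
    have hr' : r ∈ homogeneousSubmodule (Fin 2) k j * homogeneousSubmodule (Fin 2) k N := by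
      rw [← homogeneousSubmodule_one_pow _ j, ← homogeneousSubmodule_one_pow _ N, ← pow_add,
        homogeneousSubmodule_one_pow, add_comm]
      exact hr
    clear hr
    refine Submodule.mul_induction_on hr' (fun a _ b hb => ?_) (fun x y h1 h2 => ?_)
    · have := hcL b hb
      have e : f * (lin c * (a * b)) = a * (f * (lin c * b)) := by ring
      rw [e]; exact I.mul_mem_left _ this
    · have e : f * (lin c * (x + y)) = f * (lin c * x) + f * (lin c * y) := by ring
      rw [e]; exact I.add_mem h1 h2
  -- K
  have hzf : (lin c * f).IsHomogeneous (1 + d) := (lin_hom c).mul hfhom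
  have hKhom := add_hom hIhom hzf
  have hIK : I ≤ I + Ideal.span {lin c * f} := le_sup_left
  have hKI' : I + Ideal.span {lin c * f} ≤ I + Ideal.span {f} := by
    refine sup_le hle ?_
    rw [Ideal.span_le]
    simpa using Ideal.mul_mem_left _ _ hfI'
  obtain ⟨N5, hN5⟩ := slope_le hKhom (hIK hp) hp0 hpo
  have hnuK : nu (I + Ideal.span {lin c * f}) ≤ nu I := by
    let n := N + N5 + d + 1
    have e : HI (I + Ideal.span {lin c * f}) n ≤ HI I n := by
      intro q hq
      obtain ⟨hq1, hq2⟩ := mem_HI.1 hq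
      refine mem_HI.2 ⟨?_, hq2⟩
      obtain ⟨i, hi, hin, h | ⟨m, r, hm, hr, h⟩⟩ := hc_add_mul hIhom hzf hq1 n
      · omega
      · rw [homogeneousComponent_eq_self hq2] at h
        rw [h]
        refine I.add_mem hi ?_
        have := hcL' (m - N) r (by convert hr using 1; omega)
        convert this using 1; ring
    have h1 := Submodule.finrank_mono e
    have h2 := hN5 n (by omega)
    have h3 := hN2 n (by omega)
    omega
  have hzI : lin c * f ∈ I := by
    obtain ⟨i, hi, h⟩ := le_of_inj hIK hnuK
      (fun q hq hq2 => inj_of_nu hmu hq (Ideal.mul_mono_right hKI' hq2))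
      (p := lin c * f) (Ideal.mem_sup_right (Ideal.mem_span_singleton_self _))
    obtain ⟨a, ha, b, hb, hab⟩ := mem_maxIdeal_mul.1 h
    have hKd : ∀ q ∈ I + Ideal.span {lin c * f}, homogeneousComponent d q ∈ I := by
      intro q hq
      obtain ⟨i, hi, hin, h | ⟨m, r, hm, hr, h⟩⟩ := hc_add_mul hIhom hzf hq d
      · rw [h.2]; exact hi
      · omega
    have h5 := congrArg (homogeneousComponent (1 + d)) hab
    rw [map_sub, map_add, homogeneousComponent_eq_self hzf, hc_mul (isHomogeneous_X k 0),
      hc_mul (isHomogeneous_X k 1), sub_eq_iff_eq_add] at h5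
    rw [h5]
    exact I.add_mem (I.add_mem (I.mul_mem_left _ (hKd a ha)) (I.mul_mem_left _ (hKd b hb))) (hIhom i hi _)
  refine ⟨lin c, lin_ne_zero hc, lin_hom c, le_antisymm ?_ ?_⟩
  · intro q hq
    rw [mem_colon_one] at hq
    apply mem_of_hc
    intro j
    rw [Ideal.mem_span_singleton]
    have hh := homogeneousComponent_isHomogeneous j q
    have hfq : f * homogeneousComponent j q ∈ I := by
      rw [← hc_mul hfhom]; exact hIhom _ hq _
    generalize homogeneousComponent j q = q' at *
    apply eval_ker hc hh
    by_contra hne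
    obtain ⟨w, hw, hwI⟩ := fact1 (N + j) (by omega)
    apply hwI
    obtain ⟨i, hi⟩ : ∃ i, c i ≠ 0 := by
      by_contra! hall; exact hc (funext hall)
    have hh2 : (X i ^ N * q').IsHomogeneous (N + j) := by
      simpa using ((isHomogeneous_X k i).pow N).mul hh
    have hv : eval c (X i ^ N * q') ≠ 0 := by
      simp [hi, hne]
    let t := eval c w / eval c (X i ^ N * q')
    have hdv : lin c ∣ w - C t * (X i ^ N * q') := by
      apply eval_ker hc (n := N + j)
      · refine hw.sub ?_
        simpa using (isHomogeneous_C (Fin 2) t).mul hh2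
      · rw [map_sub, map_mul, eval_C, div_mul_cancel₀ _ hv, sub_self]
    obtain ⟨v, hv⟩ := hdv
    have : f * w = v * (lin c * f) + C t * X i ^ N * (f * q') := by
      linear_combination f * hv
    rw [this]
    exact I.add_mem (I.mul_mem_left _ hzI) (I.mul_mem_left _ hfq)
  · rw [Ideal.span_le]
    intro q hq
    rw [Set.mem_singleton_iff.1 hq, SetLike.mem_coe, mem_colon_one, mul_comm]
    exact hzI

end FullAux

theorem colon_eq_span_linear_of_full_sum {k : Type*} [Field k] [Infinite k]
    (I : Ideal (MvPolynomial (Fin 2) k))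
    (hI0 : I ≠ ⊥) (hItop : I ≠ ⊤)
    (hIhom : IsHomogeneousIdeal I) (hIfull : IsFull I)
    (f : MvPolynomial (Fin 2) k) (d : ℕ) (hf0 : f ≠ 0) (hfhom : f.IsHomogeneous d)
    (hd : ordDeg I ≤ d)
    (hsumfull : IsFull (I + Ideal.span {f}))
    (hmu : mu (I + Ideal.span {f}) = mu I + 1) :
    ∃ z : MvPolynomial (Fin 2) k, z ≠ 0 ∧ z.IsHomogeneous 1 ∧
      Submodule.colon I (Ideal.span {f}) = Ideal.span {z} := by
  exact FullAux.main I hI0 hIhom hIfull f d hfhom hd hsumfull hmu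

end
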